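/- For all integers k ≥ 0, n = 2^k, t ≥ 0, and m ≥ 1 with t + m ≤ n, there exist integers k' with 0 ≤ k' ≤ k and t' ≥ 0 such that 4·2^{k'} ≥ m, t' is divisible by 2^{k'}, t ≤ t', and t' + 2^{k'} ≤ t + m. (Every contiguous window of length m inside {1,…,2^k} contains a dyadically aligned block of length at least m/4.) -/

import Mathlib

/-- **Every window contains a large dyadically aligned block.**
For `n = 2^k` and any contiguous window of length `m ≥ 1` inside `{1,…,n}`
starting after position `t` (so the window is `{t+1, …, t+m}` with `t + m ≤ n`),
there are `k' ≤ k` and `t'` with `2^{k'} ∣ t'`, `t ≤ t'`,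
`t' + 2^{k'} ≤ t + m`, and `4·2^{k'} ≥ m`: the window contains a dyadically
aligned block of length at least `m/4`. -/
theorem window_contains_aligned_block
    (k n t m : ℕ) (hn : n = 2 ^ k) (hm : 1 ≤ m) (htm : t + m ≤ n) :
    ∃ k' t' : ℕ, k' ≤ k ∧ m ≤ 4 * 2 ^ k' ∧ 2 ^ k' ∣ t' ∧ t ≤ t' ∧
      t' + 2 ^ k' ≤ t + m := by
  rcases Nat.lt_or_ge m 2 with h | h
  · exact ⟨0, t, Nat.zero_le _, by omega, by simp, le_refl _, by omega⟩
  · obtain ⟨j, hj⟩ : ∃ j, Nat.log 2 m = j + 1 :=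
      Nat.exists_eq_succ_of_ne_zero (Nat.log_pos (by norm_num) h).ne'
    have h1 : 2 ^ (j + 1) ≤ m := hj ▸ Nat.pow_log_le_self 2 (by omega)
    have h2 : m < 2 ^ (j + 1 + 1) := hj ▸ Nat.lt_pow_succ_log_self (by norm_num) m
    have hjk : j ≤ k := by
      have h3 : 2 ^ (j + 1) ≤ 2 ^ k := by omega
      have := (Nat.pow_le_pow_iff_right (by norm_num : 1 < 2)).1 h3
      omega
    have hd : 0 < 2 ^ j := by positivity
    rw [pow_succ] at h1
    rw [pow_succ, pow_succ] at h2
    have e := Nat.div_add_mod (t + 2 ^ j - 1) (2 ^ j)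
    have l := Nat.mod_lt (t + 2 ^ j - 1) hd
    exact ⟨j, 2 ^ j * ((t + 2 ^ j - 1) / 2 ^ j), hjk, by omega, Dvd.intro _ rfl,
      by omega, by omega⟩
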